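/- Let H be a complex Hilbert space and let M_A and M_B be von Neumann algebras on H that commute (a * b = b * a for all a ∈ M_A, b ∈ M_B). Then the pair (M_A, M_B) has the Uhlmann property if and only if the pair (M_B, M_A) has the Uhlmann property (with the roles of the two algebras exchanged). In particular, the Uhlmann property is symmetric in the two subsystems. -/

import Mathlib

open scoped InnerProductSpace

/-- The pair `(M_A, M_B)` of von Neumann algebras has the *Uhlmann property* if any two
unit vectors inducing the same state on `M_A` can be mapped onto each other, up to
arbitrarily small error, by unitaries of `M_B`. -/
def UhlmannProperty {H : Type*} [NormedAddCommGroup H] [InnerProductSpace ℂ H]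
    [CompleteSpace H] (M_A M_B : VonNeumannAlgebra H) : Prop :=
  ∀ Ψ Φ : H, ‖Ψ‖ = 1 → ‖Φ‖ = 1 →
    (∀ a ∈ M_A, ⟪Ψ, a Ψ⟫_ℂ = ⟪Φ, a Φ⟫_ℂ) →
    ∀ ε : ℝ, 0 < ε →
      ∃ u ∈ M_B, star u * u = 1 ∧ u * star u = 1 ∧ ‖⟪Ψ, u Φ⟫_ℂ‖ ≥ 1 - ε

section Helpers

open Complex

/-- Gardner's lemma. -/
theorem gardner_aux {A : Type*} [CStarAlgebra A] (x u : A) (hx : ‖x‖ < 1) (hu : u ∈ unitary A) :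
    ∃ u₁ ∈ unitary A, ∃ u₂ ∈ unitary A, u + x = u₁ + u₂ := by
  let _ := CStarAlgebra.spectralOrder A
  let _ := CStarAlgebra.spectralOrderedRing A
  obtain (_ | _) := subsingleton_or_nontrivial A
  · exact ⟨u, hu, u, hu, Subsingleton.elim _ _⟩
  have hsu : star u ∈ unitary A := Unitary.star_mem hu
  have hnu : ‖star u * x‖ < 1 := by
    rw [CStarRing.norm_mem_unitary_mul _ hsu]; exact hx
  set a : A := (2⁻¹ : ℂ) • (1 + star u * x) with ha
  have haU : IsUnit a := by
    have h1 : IsUnit (1 + star u * x) := by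
      have := isUnit_one_sub_of_norm_lt_one (x := -(star u * x)) (by simpa using hnu)
      simpa using this
    have h2 : IsUnit (algebraMap ℂ A 2⁻¹) := (IsUnit.mk0 (2⁻¹ : ℂ) (by norm_num)).map _
    rw [ha, Algebra.smul_def]
    exact h2.mul h1
  have hna : ‖a‖ ≤ 1 := by
    rw [ha, norm_smul]
    have := norm_add_le (1 : A) (star u * x)
    rw [norm_one] at this
    have h2 : ‖(2⁻¹ : ℂ)‖ = 2⁻¹ := by simp
    rw [h2]; linarith
  set h : A := CFC.abs a with hh
  have hsa : IsSelfAdjoint h := (CFC.abs_nonneg a).isSelfAdjoint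
  have hmul : h * h = star a * a := CFC.abs_mul_abs a
  have hnh : ‖h‖ ≤ 1 := by
    rw [hh, CFC.norm_abs]; exact hna
  have hhU : IsUnit h := by
    have h3 : IsUnit (h * h) := by rw [hmul]; exact haU.star.mul haU
    exact ((Commute.refl h).isUnit_mul_iff.1 h3).1
  obtain ⟨hu', hhu'⟩ := hhU
  set k : A := ((hu'⁻¹ : Aˣ) : A) with hk
  have hk1 : h * k = 1 := by rw [← hhu', hk]; simp
  have hk2 : k * h = 1 := by rw [← hhu', hk]; simp
  have hks : star k = k := by
    have : star k * h = 1 := by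
      have := congrArg star hk1
      rwa [star_mul, hsa.star_eq, star_one] at this
    calc star k = star k * (h * k) := by rw [hk1, mul_one]
      _ = k := by rw [← mul_assoc, this, one_mul]
  have hw1 : star (a * k) * (a * k) = 1 := by
    rw [star_mul, hks]
    calc k * star a * (a * k) = k * (star a * a) * k := by noncomm_ring
      _ = (k * h) * (h * k) := by rw [← hmul]; noncomm_ring
      _ = 1 := by rw [hk1, hk2, one_mul]
  have hwU : IsUnit (a * k) := haU.mul (by rw [hk]; exact Units.isUnit _)
  have hw2 : (a * k) * star (a * k) = 1 := by
    apply hwU.mul_right_cancel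
    rw [mul_assoc, hw1, mul_one, one_mul]
  have hw : a * k ∈ unitary A := Unitary.mem_iff.2 ⟨hw1, hw2⟩
  have hv := hsa.self_add_I_smul_cfcSqrt_sub_sq_mem_unitary h hnh
  set s := CFC.sqrt (1 - h ^ 2) with hs
  have hss : IsSelfAdjoint s := (CFC.sqrt_nonneg _).isSelfAdjoint
  have hvs : star (h + I • s) = h - I • s := by
    simp [hsa.star_eq, hss.star_eq, sub_eq_add_neg]
  refine ⟨u * (a * k) * (h + I • s), mul_mem (mul_mem hu hw) hv,
    u * (a * k) * star (h + I • s), mul_mem (mul_mem hu hw) (Unitary.star_mem hv), ?_⟩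
  rw [hvs, ← mul_add]
  have e1 : h + I • s + (h - I • s) = (2 : ℂ) • h := by module
  rw [e1, mul_smul_comm, mul_assoc u, mul_assoc a, hk2, mul_one, ha, mul_smul_comm, smul_smul,
    mul_add, ← mul_assoc, (Unitary.mem_iff.1 hu).2]
  norm_num

theorem functional_bound {A : Type*} [CStarAlgebra A] (φ : A →ₗ[ℂ] ℂ) (s : ℝ)
    (hs : ∀ u ∈ unitary A, ‖φ u‖ ≤ s) (x : A) (hx : ‖x‖ < 1) : ‖φ x‖ ≤ s := by
  have key : ∀ n : ℕ, ∀ u ∈ unitary A, ‖(n : ℂ) * φ x + φ u‖ ≤ (n + 1) * s := by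
    intro n
    induction n with
    | zero => intro u hu; simpa using hs u hu
    | succ n ih =>
      intro u hu
      obtain ⟨u₁, h₁, u₂, h₂, he⟩ := gardner_aux x u hx hu
      have he' : φ u + φ x = φ u₁ + φ u₂ := by rw [← map_add, he, map_add]
      have : ((n + 1 : ℕ) : ℂ) * φ x + φ u = ((n : ℂ) * φ x + φ u₁) + φ u₂ := by
        push_cast; linear_combination he'
      rw [this]
      refine (norm_add_le _ _).trans ?_
      have := ih u₁ h₁
      have := hs u₂ h₂
      push_cast; linarith
  have key2 : ∀ n : ℕ, (n : ℝ) * (‖φ x‖ - s) ≤ 2 * s := by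
    intro n
    have h1 := key n 1 (one_mem _)
    have h2 := hs 1 (one_mem _)
    have h3 : ‖(n : ℂ) * φ x‖ ≤ ‖(n : ℂ) * φ x + φ 1‖ + ‖φ 1‖ := by
      simpa using norm_sub_le ((n : ℂ) * φ x + φ 1) (φ 1)
    rw [norm_mul, Complex.norm_natCast] at h3
    linarith
  by_contra hcon
  push Not at hcon
  obtain ⟨n, hn⟩ := exists_nat_gt (2 * s / (‖φ x‖ - s))
  rw [div_lt_iff₀ (by linarith)] at hn
  linarith [key2 n]

variable {H : Type*} [NormedAddCommGroup H] [InnerProductSpace ℂ H] [CompleteSpace H]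

theorem vn_isClosed (M : VonNeumannAlgebra H) : IsClosed (M : Set (H →L[ℂ] H)) := by
  rw [← M.centralizer_centralizer]
  exact Set.isClosed_centralizer _

theorem vn_exists_unitary (M : VonNeumannAlgebra H) (Ψ Φ : H) (v : H →L[ℂ] H) (hvM : v ∈ M)
    (hv : ‖v‖ ≤ 1) (h1 : ⟪Ψ, v Φ⟫_ℂ = 1) (ε : ℝ) (hε : 0 < ε) :
    ∃ u ∈ M, star u * u = 1 ∧ u * star u = 1 ∧ ‖⟪Ψ, u Φ⟫_ℂ‖ ≥ 1 - ε := by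
  by_contra! hcon
  haveI : IsClosed (M.toStarSubalgebra : Set (H →L[ℂ] H)) := vn_isClosed M
  let φ : M.toStarSubalgebra →ₗ[ℂ] ℂ :=
    { toFun := fun x => ⟪Ψ, (x : H →L[ℂ] H) Φ⟫_ℂ
      map_add' := fun x y => by simp [inner_add_right]
      map_smul' := fun c x => by simp [inner_smul_right] }
  have hs : ∀ u ∈ unitary M.toStarSubalgebra, ‖φ u‖ ≤ 1 - ε := by
    intro u hu
    obtain ⟨h1, h2⟩ := Unitary.mem_iff.1 hu
    exact (hcon u u.2 (congrArg Subtype.val h1) (congrArg Subtype.val h2)).le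
  have hε1 : ε ≤ 1 := by
    have := (norm_nonneg _).trans (hs 1 (one_mem _)); linarith
  have := functional_bound φ (1 - ε) hs (((1 - ε / 2 : ℝ) : ℂ) • ⟨v, hvM⟩) (by
    rw [norm_smul, Complex.norm_real, Real.norm_of_nonneg (by linarith)]
    have : ‖(⟨v, hvM⟩ : M.toStarSubalgebra)‖ ≤ 1 := hv
    nlinarith)
  rw [map_smul] at this
  have h2 : φ ⟨v, hvM⟩ = 1 := h1
  rw [h2, smul_eq_mul, mul_one, Complex.norm_real, Real.norm_of_nonneg (by linarith)] at this
  linarith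

theorem vn_exists_partial (M : VonNeumannAlgebra H) (Ψ Φ : H)
    (hst : ∀ a ∈ M, ⟪Ψ, a Ψ⟫_ℂ = ⟪Φ, a Φ⟫_ℂ) :
    ∃ v ∈ M.commutant, ‖v‖ ≤ 1 ∧ v Φ = Ψ := by
  let ev (ξ : H) : M.toStarSubalgebra →ₗ[ℂ] H :=
    { toFun := fun x => (x : H →L[ℂ] H) ξ
      map_add' := fun x y => by simp
      map_smul' := fun c x => by simp }
  have hnorm : ∀ a : M.toStarSubalgebra, ‖ev Ψ a‖ = ‖ev Φ a‖ := by
    intro a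
    have h := hst (star (a : H →L[ℂ] H) * a) (mul_mem (star_mem a.2) a.2)
    simp only [ContinuousLinearMap.mul_apply, ContinuousLinearMap.star_eq_adjoint,
      ContinuousLinearMap.adjoint_inner_right, inner_self_eq_norm_sq_to_K] at h
    have h' : ‖(a : H →L[ℂ] H) Ψ‖ ^ 2 = ‖(a : H →L[ℂ] H) Φ‖ ^ 2 := by exact_mod_cast h
    exact (sq_eq_sq₀ (norm_nonneg _) (norm_nonneg _)).1 h'
  set R : Submodule ℂ H := LinearMap.range (ev Φ) with hR
  set K : Submodule ℂ H := R.topologicalClosure with hK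
  haveI : CompleteSpace K := R.isClosed_topologicalClosure.completeSpace_coe
  have hmem : ∀ a, ev Φ a ∈ K := fun a => R.le_topologicalClosure ⟨a, rfl⟩
  let e : M.toStarSubalgebra →ₗ[ℂ] K := (ev Φ).codRestrict K hmem
  have hdense : DenseRange e := by
    intro k
    have hk : (k : H) ∈ closure (R : Set H) := k.2
    rw [Metric.mem_closure_iff] at hk ⊢
    intro ε hε
    obtain ⟨_, ⟨a, rfl⟩, hb⟩ := hk ε hε
    exact ⟨e a, ⟨a, rfl⟩, hb⟩
  have hle : ∀ a, ‖ev Ψ a‖ ≤ 1 * ‖e a‖ := fun a => by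
    rw [one_mul]; exact (hnorm a).le
  let V0 : K →L[ℂ] H := (ev Ψ).extendOfNorm e
  have hV0 : ∀ a, V0 (e a) = ev Ψ a := LinearMap.extendOfNorm_eq hdense ⟨1, hle⟩
  have hV0n : ‖V0‖ ≤ 1 := LinearMap.opNorm_extendOfNorm_le hdense zero_le_one hle
  let V : H →L[ℂ] H := V0 ∘L K.orthogonalProjection
  have hVa : ∀ a : M.toStarSubalgebra, V (ev Φ a) = ev Ψ a := by
    intro a
    have : K.orthogonalProjection (ev Φ a) = e a :=
      K.orthogonalProjection_mem_subspace_eq_self (e a)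
    simp only [V, ContinuousLinearMap.comp_apply, this, hV0]
  refine ⟨V, ?_, ?_, ?_⟩
  · rw [VonNeumannAlgebra.mem_commutant_iff]
    intro b hb
    have hbK : ∀ k ∈ K, b k ∈ K := by
      intro k hk
      refine map_mem_closure b.continuous hk ?_
      rintro _ ⟨a, rfl⟩
      exact ⟨⟨b, hb⟩ * a, rfl⟩
    have hP : K.starProjection ∈ M.commutant := by
      rw [VonNeumannAlgebra.IsStarProjection.mem_iff isStarProjection_starProjection]
      intro y hy
      rw [VonNeumannAlgebra.commutant_commutant] at hy
      rw [Submodule.range_starProjection]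
      intro k hk
      refine map_mem_closure y.continuous hk ?_
      rintro _ ⟨a, rfl⟩
      exact ⟨⟨y, hy⟩ * a, rfl⟩
    have hPb := VonNeumannAlgebra.mem_commutant_iff.1 hP b hb
    have hcK : ∀ k ∈ K, b (V k) = V (b k) := by
      intro k hk
      have hcl : IsClosed {k : H | b (V k) = V (b k)} :=
        isClosed_eq (by fun_prop) (by fun_prop)
      refine closure_minimal ?_ hcl hk
      rintro _ ⟨a, rfl⟩
      have h2 := hVa (⟨b, hb⟩ * a)
      show b (V (ev Φ a)) = V (ev Φ (⟨b, hb⟩ * a))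
      rw [hVa, h2]; rfl
    have hVP : ∀ ξ, V ξ = V (K.starProjection ξ) := by
      intro ξ
      have : K.orthogonalProjection (K.starProjection ξ) = K.orthogonalProjection ξ :=
        K.orthogonalProjection_mem_subspace_eq_self (K.orthogonalProjection ξ)
      simp only [V, ContinuousLinearMap.comp_apply, this]
    ext ξ
    have h3 : b (K.starProjection ξ) = K.starProjection (b ξ) := congrArg (fun T => T ξ) hPb
    show b (V ξ) = V (b ξ)
    rw [hVP ξ, hVP (b ξ), ← h3]
    exact hcK _ (K.starProjection_apply_mem ξ)
  · refine (ContinuousLinearMap.opNorm_comp_le _ _).trans ?_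
    have := K.orthogonalProjection_norm_le
    exact mul_le_one₀ hV0n (norm_nonneg _) this
  · have := hVa 1
    simpa [ev] using this

theorem uhlmann_of_haag (M : VonNeumannAlgebra H) : UhlmannProperty M M.commutant := by
  intro Ψ Φ hΨ _ hst ε hε
  obtain ⟨v, hvM, hv, hvΦ⟩ := vn_exists_partial M Ψ Φ hst
  refine vn_exists_unitary _ Ψ Φ v hvM hv ?_ ε hε
  rw [hvΦ, inner_self_eq_norm_sq_to_K, hΨ]; simp

theorem inner_diff_bound (ξ η : H) (x : H →L[ℂ] H) (hξ : ‖ξ‖ = 1) (hη : ‖η‖ = 1) (δ : ℝ)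
    (hδ : 0 < δ) (hδ1 : δ < 1) (h : ‖⟪ξ, η⟫_ℂ‖ ≥ 1 - δ ^ 2 / 2) :
    ‖⟪ξ, x ξ⟫_ℂ - ⟪η, x η⟫_ℂ‖ ≤ 3 * δ * ‖x‖ := by
  set c := ⟪η, ξ⟫_ℂ with hc
  have hcn : ‖c‖ = ‖⟪ξ, η⟫_ℂ‖ := norm_inner_symm _ _
  have hc1 : ‖c‖ ≤ 1 := by
    have := norm_inner_le_norm (𝕜 := ℂ) η ξ
    rwa [hξ, hη, one_mul] at this
  set d := ξ - c • η with hd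
  have horth : ⟪c • η, d⟫_ℂ = 0 := by
    rw [hd, inner_sub_right, inner_smul_left, inner_smul_left, inner_smul_right,
      inner_self_eq_norm_sq_to_K, hη, ← hc]
    simp
  have hsum : c • η + d = ξ := by rw [hd]; abel
  have hpyth : 1 = ‖c‖ ^ 2 + ‖d‖ ^ 2 := by
    have := norm_add_sq_eq_norm_sq_add_norm_sq_of_inner_eq_zero (c • η) d horth
    rw [hsum, hξ, norm_smul, hη] at this
    nlinarith
  have hdδ : ‖d‖ ≤ δ := by
    refine abs_le_of_sq_le_sq' ?_ hδ.le |>.2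
    rw [← hcn] at h
    nlinarith
  have hq : ‖⟪η, x η⟫_ℂ‖ ≤ ‖x‖ := by
    refine (norm_inner_le_norm _ _).trans ?_
    have := x.le_opNorm η
    rw [hη] at *; linarith
  have h1 : ‖⟪ξ, x d⟫_ℂ‖ ≤ ‖x‖ * δ := by
    refine (norm_inner_le_norm _ _).trans ?_
    rw [hξ, one_mul]
    exact (x.le_opNorm d).trans (by gcongr)
  have h2 : ‖⟪d, x (c • η)⟫_ℂ‖ ≤ ‖x‖ * δ := by
    refine (norm_inner_le_norm _ _).trans ?_
    have h3 : ‖x (c • η)‖ ≤ ‖x‖ := by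
      refine (x.le_opNorm _).trans ?_
      rw [norm_smul, hη, mul_one]
      exact mul_le_of_le_one_right (norm_nonneg _) hc1
    rw [mul_comm]
    gcongr
  have hexp : ⟪ξ, x ξ⟫_ℂ - ⟪η, x η⟫_ℂ =
      ⟪ξ, x d⟫_ℂ + ⟪d, x (c • η)⟫_ℂ - ((‖d‖ ^ 2 : ℝ) : ℂ) * ⟪η, x η⟫_ℂ := by
    have e1 : ⟪ξ, x ξ⟫_ℂ = ⟪ξ, x (c • η)⟫_ℂ + ⟪ξ, x d⟫_ℂ := by
      rw [← inner_add_right, ← map_add, hsum]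
    have e2 : ⟪ξ, x (c • η)⟫_ℂ = ⟪c • η, x (c • η)⟫_ℂ + ⟪d, x (c • η)⟫_ℂ := by
      rw [← inner_add_left, hsum]
    have e3 : ⟪c • η, x (c • η)⟫_ℂ = ((‖c‖ ^ 2 : ℝ) : ℂ) * ⟪η, x η⟫_ℂ := by
      rw [map_smul, inner_smul_left, inner_smul_right, ← mul_assoc, Complex.conj_mul']
      push_cast; rfl
    have e4 : ((‖c‖ ^ 2 : ℝ) : ℂ) = 1 - ((‖d‖ ^ 2 : ℝ) : ℂ) := by
      rw [eq_sub_iff_add_eq, ← Complex.ofReal_add, ← hpyth]; simp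
    rw [e1, e2, e3, e4]; ring
  rw [hexp]
  refine (norm_sub_le _ _).trans ?_
  have h4 : ‖((‖d‖ ^ 2 : ℝ) : ℂ) * ⟪η, x η⟫_ℂ‖ ≤ δ * ‖x‖ := by
    rw [norm_mul, Complex.norm_real, Real.norm_of_nonneg (by positivity)]
    have : ‖d‖ ^ 2 ≤ δ := by nlinarith [norm_nonneg d]
    gcongr
  have := norm_add_le ⟪ξ, x d⟫_ℂ ⟪d, x (c • η)⟫_ℂ
  linarith

theorem unitary_mem_of_uhlmann (M_A M_B : VonNeumannAlgebra H) (hU : UhlmannProperty M_A M_B)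
    (u : H →L[ℂ] H) (hu : u ∈ M_A.commutant) (hu1 : star u * u = 1) (hu2 : u * star u = 1) :
    u ∈ M_B := by
  have iso : ∀ w : H →L[ℂ] H, star w * w = 1 → ∀ ξ ζ, ⟪w ξ, w ζ⟫_ℂ = ⟪ξ, ζ⟫_ℂ := by
    intro w hw ξ ζ
    rw [← ContinuousLinearMap.adjoint_inner_right, ← ContinuousLinearMap.star_eq_adjoint,
      ← ContinuousLinearMap.mul_apply, hw]; rfl
  have ison : ∀ w : H →L[ℂ] H, star w * w = 1 → ∀ ξ, ‖w ξ‖ = ‖ξ‖ := by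
    intro w hw ξ
    rw [@norm_eq_sqrt_re_inner ℂ, @norm_eq_sqrt_re_inner ℂ _ _ _ _ ξ, iso w hw]
  rw [← M_B.commutant_commutant, VonNeumannAlgebra.mem_commutant_iff]
  intro x hx
  have hunit : ∀ Ψ : H, ‖Ψ‖ = 1 → ⟪u Ψ, x (u Ψ)⟫_ℂ = ⟪Ψ, x Ψ⟫_ℂ := by
    intro Ψ hΨ
    have hst : ∀ a ∈ M_A, ⟪u Ψ, a (u Ψ)⟫_ℂ = ⟪Ψ, a Ψ⟫_ℂ := by
      intro a ha
      have h1 := VonNeumannAlgebra.mem_commutant_iff.1 hu a ha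
      have h2 : a (u Ψ) = u (a Ψ) := congrArg (fun T => T Ψ) h1
      rw [h2, iso u hu1]
    have hb : ∀ δ : ℝ, 0 < δ → δ < 1 → ‖⟪u Ψ, x (u Ψ)⟫_ℂ - ⟪Ψ, x Ψ⟫_ℂ‖ ≤ 3 * δ * ‖x‖ := by
      intro δ h0 h1
      obtain ⟨v, hvM, hv1, -, hv⟩ := hU (u Ψ) Ψ ((ison u hu1 Ψ).trans hΨ) hΨ hst (δ ^ 2 / 2)
        (by positivity)
      have h2 := VonNeumannAlgebra.mem_commutant_iff.1 hx v hvM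
      have h3 : v (x Ψ) = x (v Ψ) := congrArg (fun T => T Ψ) h2
      have h4 : ⟪v Ψ, x (v Ψ)⟫_ℂ = ⟪Ψ, x Ψ⟫_ℂ := by rw [← h3, iso v hv1]
      rw [← h4]
      exact inner_diff_bound (u Ψ) (v Ψ) x ((ison u hu1 Ψ).trans hΨ) ((ison v hv1 Ψ).trans hΨ)
        δ h0 h1 hv
    rw [← sub_eq_zero, ← norm_le_zero_iff]
    have hlim : Filter.Tendsto (fun δ : ℝ => 3 * δ * ‖x‖) (nhdsWithin 0 (Set.Ioi 0)) (nhds 0) := by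
      have : Continuous (fun δ : ℝ => 3 * δ * ‖x‖) := by fun_prop
      have h := this.tendsto 0
      simp only [mul_zero, zero_mul] at h
      exact h.mono_left nhdsWithin_le_nhds
    refine ge_of_tendsto hlim ?_
    filter_upwards [Ioo_mem_nhdsGT (zero_lt_one' ℝ)] with δ hδ
    exact hb δ hδ.1 hδ.2
  have hall : ∀ Ψ : H, ⟪u Ψ, x (u Ψ)⟫_ℂ = ⟪Ψ, x Ψ⟫_ℂ := by
    intro Ψ
    by_cases h0 : Ψ = 0
    · simp [h0]
    have hn : (‖Ψ‖ : ℂ) ≠ 0 := by simpa using h0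
    have h1 := hunit ((‖Ψ‖ : ℂ)⁻¹ • Ψ) (by
      rw [norm_smul, norm_inv, Complex.norm_real, norm_norm]
      exact inv_mul_cancel₀ (by simpa using h0))
    simp only [map_smul, inner_smul_left, inner_smul_right] at h1
    have hn' : (starRingEnd ℂ) ((‖Ψ‖ : ℂ)⁻¹) ≠ 0 := by simpa using h0
    exact mul_left_cancel₀ hn' (mul_left_cancel₀ (inv_ne_zero hn) h1)
  have hmain : star u * x * u = x := by
    have : ((star u * x * u : H →L[ℂ] H) : H →ₗ[ℂ] H) = (x : H →ₗ[ℂ] H) := by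
      rw [← ext_inner_map]
      intro Ψ
      show ⟪(star u) (x (u Ψ)), Ψ⟫_ℂ = ⟪x Ψ, Ψ⟫_ℂ
      rw [ContinuousLinearMap.star_eq_adjoint, ContinuousLinearMap.adjoint_inner_left,
        ← inner_conj_symm, hall, inner_conj_symm]
    exact ContinuousLinearMap.coe_injective this
  calc x * u = (u * star u) * x * u := by rw [hu2, one_mul]
    _ = u * (star u * x * u) := by simp only [mul_assoc]
    _ = u * x := by rw [hmain]

theorem haag_of_uhlmann (M_A M_B : VonNeumannAlgebra H)
    (hcomm : ∀ a ∈ M_A, ∀ b ∈ M_B, a * b = b * a) (hU : UhlmannProperty M_A M_B) :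
    M_B = M_A.commutant := by
  ext x
  constructor
  · intro hx
    rw [VonNeumannAlgebra.mem_commutant_iff]
    exact fun a ha => hcomm a ha x hx
  · intro hx
    haveI : IsClosed (M_A.commutant.toStarSubalgebra : Set (H →L[ℂ] H)) := vn_isClosed _
    obtain ⟨u, c, he, -⟩ :=
      CStarAlgebra.exists_sum_four_unitary (⟨x, hx⟩ : M_A.commutant.toStarSubalgebra)
    have he' : x = ∑ i, c i • ((u i : M_A.commutant.toStarSubalgebra) : H →L[ℂ] H) := by
      have := congrArg Subtype.val he
      simpa using this
    rw [he']
    refine (sum_mem fun i _ => ?_ : _ ∈ M_B.toStarSubalgebra)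
    refine SMulMemClass.smul_mem (c i) ?_
    obtain ⟨h1, h2⟩ := Unitary.mem_iff.1 (u i).2
    exact unitary_mem_of_uhlmann M_A M_B hU _ (u i).1.2 (congrArg Subtype.val h1)
      (congrArg Subtype.val h2)

end Helpers

/-- The Uhlmann property is symmetric in the two subsystems. -/
theorem uhlmannProperty_symm {H : Type*} [NormedAddCommGroup H]
    [InnerProductSpace ℂ H] [CompleteSpace H]
    (M_A M_B : VonNeumannAlgebra H)
    (hcomm : ∀ a ∈ M_A, ∀ b ∈ M_B, a * b = b * a) :
    UhlmannProperty M_A M_B ↔ UhlmannProperty M_B M_A := by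
  constructor
  · intro hU
    have h := haag_of_uhlmann M_A M_B hcomm hU
    have h2 : M_A = M_B.commutant := by rw [h, VonNeumannAlgebra.commutant_commutant]
    rw [h2]
    exact uhlmann_of_haag M_B
  · intro hU
    have h := haag_of_uhlmann M_B M_A (fun b hb a ha => (hcomm a ha b hb).symm) hU
    have h2 : M_B = M_A.commutant := by rw [h, VonNeumannAlgebra.commutant_commutant]
    rw [h2]
    exact uhlmann_of_haag M_A
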